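/- arXiv:2202.12208 — 4 statements merged into one kernel-verified Lean document; each statement's English description precedes it below -/
import Mathlib

section
/- Let R be the relation of a keyword preorder with a distinguished index i* whose operator is ≤, and let f be the feature map sending a to the tuple of key values (k i a) over all indices i ≠ i*. For every finite subset S of A there exists T ⊆ S such that T R-covers S and the cardinality of T is at most the number of distinct feature vectors, i.e., |T| ≤ |f '' S| (the cardinality of the image of S under f). -/
/-- The relation associated with a keyword preorder: `op i = true` means the
comparison operator for index `i` is `≤`, and `op i = false` means it is `=`. -/
def kwRel {A ι : Type*} (k : ι → A → ℤ) (op : ι → Bool) (a b : A) : Prop :=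
  ∀ i : ι, if op i then k i a ≤ k i b else k i a = k i b

/-- Choosing in each fibre of `f` an element maximizing `g` covers a finite set by at most
`(S.image f).card` of its elements. -/
theorem Finset.exists_subset_card_le_image_forall_exists_le {A B C : Type*} [DecidableEq A]
    [DecidableEq B] [LinearOrder C] (f : A → B) (g : A → C) (S : Finset A) :
    ∃ T ⊆ S, (∀ a ∈ S, ∃ b ∈ T, f a = f b ∧ g a ≤ g b) ∧ T.card ≤ (S.image f).card := by
  have hrep : ∀ v : S.image f, ∃ b ∈ S, f b = v ∧ ∀ c ∈ S, f c = v → g c ≤ g b := by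
    rintro ⟨v, hv⟩
    obtain ⟨a, ha, hav⟩ := Finset.mem_image.1 hv
    obtain ⟨b, hb, hmax⟩ := (S.filter (f · = v)).exists_max_image g
      ⟨a, Finset.mem_filter.2 ⟨ha, hav⟩⟩
    obtain ⟨hbS, hbv⟩ := Finset.mem_filter.1 hb
    exact ⟨b, hbS, hbv, fun c hc hcv => hmax c (Finset.mem_filter.2 ⟨hc, hcv⟩)⟩
  choose r hrS hfr hle using hrep
  refine ⟨(S.image f).attach.image r, ?_, fun a ha => ?_, ?_⟩
  · intro b hb
    obtain ⟨v, -, rfl⟩ := Finset.mem_image.1 hb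
    exact hrS v
  · let v : S.image f := ⟨f a, Finset.mem_image_of_mem f ha⟩
    exact ⟨r v, Finset.mem_image_of_mem r (Finset.mem_attach _ v), (hfr v).symm, hle v a ha rfl⟩
  · exact Finset.card_image_le.trans_eq Finset.card_attach

/-- Size bound for thinning via the feature map: if the operator of the
distinguished index `istar` is `≤` and `f` sends `a` to the tuple of key values
`k i a` for `i ≠ istar`, then every finite set `S` has an `R`-covering subset
`T ⊆ S` with `|T| ≤ |f '' S|`. -/
theorem kwRel_cover_card_le_image_feature {A ι : Type*} [Fintype ι] [DecidableEq ι]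
    [DecidableEq A]
    (k : ι → A → ℤ) (op : ι → Bool) (istar : ι) (hstar : op istar = true)
    (f : A → ({i : ι // i ≠ istar} → ℤ)) (hf : ∀ a i, f a i = k i.1 a)
    (S : Finset A) :
    ∃ T ⊆ S, (∀ a ∈ S, ∃ b ∈ T, kwRel k op a b) ∧ T.card ≤ (S.image f).card := by
  obtain ⟨T, hTS, hT, hcard⟩ :=
    S.exists_subset_card_le_image_forall_exists_le f (k istar)
  refine ⟨T, hTS, fun a ha => ?_, hcard⟩
  obtain ⟨b, hb, hfab, hle⟩ := hT a ha
  refine ⟨b, hb, fun i => ?_⟩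
  by_cases hi : i = istar
  · subst hi
    simpa [hstar] using hle
  · have hk : k i a = k i b := by rw [← hf a ⟨i, hi⟩, hfab, hf]
    split_ifs
    exacts [hk.le, hk]
end

section
/- Let R be the relation of a keyword preorder, and suppose some index i* has operator ≤. For every finite subset S of A there exists T ⊆ S such that T R-covers S and |T| · |k i* '' S| ≤ ∏_{i ∈ ι} |k i '' S|, where |k i '' S| denotes the number of distinct values that the key function k i takes on S. In particular, choosing i* to be a ≤-index whose key takes the most distinct values on S, the size of a smallest R-covering subset of S is at most (∏_{i} |k i '' S|) / max{ |k i '' S| : op i is ≤ }. -/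
/-- Size bound for thinning (Theorem 3.5 of the paper): if some index `istar`
has operator `≤`, then every finite set `S` has an `R`-covering subset `T ⊆ S`
with `|T| · |k istar '' S| ≤ ∏ i, |k i '' S|`, where `|k i '' S|` is the number
of distinct values of the key `k i` on `S`. -/
theorem kwRel_cover_card_bound {A ι : Type*} [Fintype ι] [DecidableEq ι]
    [DecidableEq A]
    (k : ι → A → ℤ) (op : ι → Bool) (istar : ι) (hstar : op istar = true)
    (S : Finset A) :
    ∃ T ⊆ S, (∀ a ∈ S, ∃ b ∈ T, kwRel k op a b) ∧
      T.card * (S.image (k istar)).card ≤ ∏ i : ι, (S.image (k i)).card := by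
  classical
  let f : A → {i : ι // i ≠ istar} → ℤ := fun a i => k i a
  have hmax : ∀ v ∈ S.image f, ∃ b ∈ S, f b = v ∧
      ∀ c ∈ S, f c = v → k istar c ≤ k istar b := by
    intro v hv
    obtain ⟨a, ha, rfl⟩ := Finset.mem_image.1 hv
    obtain ⟨b, hb, hle⟩ := Finset.exists_max_image (S.filter fun c => f c = f a) (k istar)
      ⟨a, Finset.mem_filter.2 ⟨ha, rfl⟩⟩
    rw [Finset.mem_filter] at hb
    exact ⟨b, hb.1, hb.2, fun c hc hca => hle c (Finset.mem_filter.2 ⟨hc, hca⟩)⟩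
  choose g hgS hgf hgle using hmax
  refine ⟨(S.image f).attach.image fun v : {v // v ∈ S.image f} => g v v.2, ?_, ?_, ?_⟩
  · intro b hb
    obtain ⟨v, -, rfl⟩ := Finset.mem_image.1 hb
    exact hgS _ _
  · intro a ha
    have hfa : f a ∈ S.image f := Finset.mem_image_of_mem f ha
    refine ⟨g (f a) hfa,
      Finset.mem_image.2 ⟨⟨f a, hfa⟩, Finset.mem_attach _ _, rfl⟩, fun i => ?_⟩
    by_cases hi : i = istar
    · subst hi
      simpa [hstar] using hgle (f a) hfa a ha rfl
    · have heq : k i (g (f a) hfa) = k i a := congrFun (hgf (f a) hfa) ⟨i, hi⟩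
      simp [heq]
  · have hsub : S.image f ⊆
        Fintype.piFinset fun i : {i : ι // i ≠ istar} => S.image (k i) := by
      intro v hv
      obtain ⟨a, ha, rfl⟩ := Finset.mem_image.1 hv
      exact Fintype.mem_piFinset.2 fun i => Finset.mem_image_of_mem (k i) ha
    have hcard := Finset.card_le_card hsub
    rw [Fintype.card_piFinset] at hcard
    rw [← Finset.prod_erase_mul Finset.univ _ (Finset.mem_univ istar),
      Finset.prod_subtype (p := fun i => i ≠ istar) (Finset.univ.erase istar) (by simp)]
    exact Nat.mul_le_mul_right _
      ((Finset.card_image_le.trans_eq Finset.card_attach).trans hcard)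
end

section
/- Let R be a preorder on a type A and let S be a finite subset of A. If T ⊆ S is minimal with respect to set inclusion among the subsets of S that R-cover S, then every element of T is R-maximal in S (i.e., for every t ∈ T and every c ∈ S, t R c implies c R t). -/
/-- If `T ⊆ S` is minimal with respect to inclusion among the subsets of a
finite set `S` that `R`-cover `S` (`R` a preorder), then every element of `T`
is `R`-maximal in `S`. -/
theorem minimal_cover_subset_maximal {A : Type*} (R : A → A → Prop)
    (hrefl : ∀ a, R a a) (htrans : ∀ a b c, R a b → R b c → R a c)
    (S T : Finset A) (hTS : T ⊆ S)
    (hcov : ∀ a ∈ S, ∃ b ∈ T, R a b)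
    (hmin : ∀ T' : Finset A, T' ⊆ S → (∀ a ∈ S, ∃ b ∈ T', R a b) → T' ⊆ T → T' = T) :
    ∀ t ∈ T, ∀ c ∈ S, R t c → R c t := by
  classical
  intro t ht c hc htc
  obtain ⟨b, hb, hcb⟩ := hcov c hc
  by_cases hbt : b = t
  · exact hbt ▸ hcb
  have herase : T.erase t = T := by
    refine hmin _ ((T.erase_subset t).trans hTS) (fun a ha => ?_) (T.erase_subset t)
    obtain ⟨d, hd, had⟩ := hcov a ha
    by_cases hdt : d = t
    · subst hdt
      exact ⟨b, Finset.mem_erase.2 ⟨hbt, hb⟩, htrans _ _ _ had (htrans _ _ _ htc hcb)⟩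
    · exact ⟨d, Finset.mem_erase.2 ⟨hdt, hd⟩, had⟩
  exact absurd ht (Finset.erase_eq_self.1 herase)
end

section
/- Let R be a relation on a type A and o : A → ℤ an objective function such that for all a, b, a R b implies o a ≤ o b. Let S be a finite nonempty subset of A and let T ⊆ S be a subset that R-covers S. Then T is nonempty and the maximum of o over T equals the maximum of o over S. -/
/-- Thinning preserves the optimum: if `R` implies `o`-dominance and `T ⊆ S`
`R`-covers the finite nonempty set `S`, then `T` is nonempty and the maximum of
the objective `o` over `T` equals its maximum over `S`. -/
theorem cover_preserves_max {A : Type*} (R : A → A → Prop) (o : A → ℤ)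
    (ho : ∀ a b, R a b → o a ≤ o b)
    (S T : Finset A) (hS : S.Nonempty) (hTS : T ⊆ S)
    (hcov : ∀ a ∈ S, ∃ b ∈ T, R a b) :
    ∃ hT : T.Nonempty, T.sup' hT o = S.sup' hS o := by
  have hT : T.Nonempty := by
    obtain ⟨a, ha⟩ := hS
    obtain ⟨b, hb, -⟩ := hcov a ha
    exact ⟨b, hb⟩
  refine ⟨hT, le_antisymm (Finset.sup'_mono o hTS hT) (Finset.sup'_le hS o fun a ha => ?_)⟩
  obtain ⟨b, hb, hab⟩ := hcov a ha
  exact (ho a b hab).trans (Finset.le_sup' o hb)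
end
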